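/- Let γ > 0 and k ≥ 1. There exists t₀ (depending only on k and γ) such that for every k-arm stochastic bandit and every realization of the rewards, a player following EpochExploreThenCommit_γ satisfies N_i^T ≥ γ·log₂ T for every arm i and every T > t₀. -/

import Mathlib

namespace Freeride

/-- The smallest index maximizing `g` (ties broken towards smaller indices). -/
noncomputable def argmaxFin {k : ℕ} [NeZero k] {α : Type*} [LinearOrder α]
    (g : Fin k → α) : Fin k :=
  if h : (Finset.univ.filter fun i => ∀ j, g j ≤ g i).Nonempty then
    (Finset.univ.filter fun i => ∀ j, g j ≤ g i).min' h
  else 0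

/-- The arm pulled in round `t` by `EpochExploreThenCommit_γ` facing reward table `X`:
in epoch `j` (rounds `2^j, …, 2^{j+1}-1`) first pull each arm in turn `⌈γ(j+2)⌉` times
(stopping early if the epoch ends), then commit to the arm with the highest sample mean
over the `⌈γ(j+2)⌉` exploration samples of that epoch. -/
noncomputable def eetcPull {k : ℕ} [NeZero k] (γ : ℝ) (X : ℕ → Fin k → ℝ) (t : ℕ) : Fin k :=
  let j := Nat.log 2 t
  let m := ⌈γ * ((j : ℝ) + 2)⌉₊
  if h : t - 2 ^ j < k * m then ⟨(t - 2 ^ j) / m, Nat.div_lt_of_lt_mul (by rw [Nat.mul_comm]; exact h)⟩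
  else argmaxFin fun i : Fin k =>
    (∑ l ∈ Finset.range m, X (2 ^ j + i.val * m + l) i) / m

/-- Number of times arm `i` is pulled in rounds `1, …, t` by the pull sequence `I`. -/
def nCount {k : ℕ} (I : ℕ → Fin k) (i : Fin k) (t : ℕ) : ℕ :=
  ((Finset.Icc 1 t).filter fun s => I s = i).card


/-- The exploration phase, of length `k * ⌈γ * (j + 2)⌉₊`, eventually fits in epoch `j`. -/
lemma eventually_mul_ceil_le_two_pow (γ : ℝ) (hγ : 0 ≤ γ) (k : ℕ) :
    ∀ᶠ j : ℕ in Filter.atTop, k * ⌈γ * ((j : ℝ) + 2)⌉₊ ≤ 2 ^ j := by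
  have h₁ := (tendsto_pow_const_div_const_pow_of_one_lt 1 (one_lt_two (α := ℝ))).const_mul
    ((k : ℝ) * γ)
  have h₀ := (tendsto_pow_const_div_const_pow_of_one_lt 0 (one_lt_two (α := ℝ))).const_mul
    ((k : ℝ) * (2 * γ + 1))
  have h := h₁.add h₀
  rw [mul_zero, mul_zero, add_zero] at h
  filter_upwards [h.eventually_le_const one_pos] with j hj
  have hpow : (0 : ℝ) < 2 ^ j := by positivity
  have hsum : (k : ℝ) * (γ * ((j : ℝ) + 2) + 1) ≤ 2 ^ j := by
    rw [pow_one, pow_zero, mul_div_assoc', mul_div_assoc', ← add_div, div_le_one hpow] at hj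
    linarith
  have hceil : (⌈γ * ((j : ℝ) + 2)⌉₊ : ℝ) ≤ γ * ((j : ℝ) + 2) + 1 :=
    (Nat.ceil_lt_add_one (by positivity)).le
  have : (k : ℝ) * ⌈γ * ((j : ℝ) + 2)⌉₊ ≤ 2 ^ j :=
    (mul_le_mul_of_nonneg_left hceil k.cast_nonneg).trans hsum
  exact_mod_cast this

/-- The offset of the `l`-th exploration sample of an arm lies in the exploration phase. -/
lemma exploration_offset_lt {k : ℕ} (i : Fin k) {m l : ℕ} (hl : l < m) :
    i.val * m + l < k * m := by
  calc i.val * m + l < i.val * m + m := by omega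
    _ = (i.val + 1) * m := by ring
    _ ≤ k * m := Nat.mul_le_mul_right m i.isLt

/-- If the exploration phase fits in epoch `j`, arm `i` is pulled in its exploration block. -/
lemma eetcPull_exploration {k : ℕ} [NeZero k] (γ : ℝ) (X : ℕ → Fin k → ℝ) {j : ℕ}
    (hj : k * ⌈γ * ((j : ℝ) + 2)⌉₊ ≤ 2 ^ j) (i : Fin k) {l : ℕ}
    (hl : l < ⌈γ * ((j : ℝ) + 2)⌉₊) :
    eetcPull γ X (2 ^ j + (i.val * ⌈γ * ((j : ℝ) + 2)⌉₊ + l)) = i := by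
  have hlt := exploration_offset_lt i hl
  have hlog : Nat.log 2 (2 ^ j + (i.val * ⌈γ * ((j : ℝ) + 2)⌉₊ + l)) = j := by
    refine Nat.log_eq_of_pow_le_of_lt_pow (by omega) ?_
    rw [pow_succ]
    omega
  unfold eetcPull
  simp only [hlog, Nat.add_sub_cancel_left]
  rw [dif_pos hlt]
  ext
  change (i.val * _ + l) / _ = i.val
  rw [mul_comm, Nat.mul_add_div (by omega), Nat.div_eq_of_lt hl, add_zero]

/-- After an epoch whose exploration phase fits, every arm has been explored in full. -/
lemma ceil_le_nCount_eetcPull {k : ℕ} [NeZero k] (γ : ℝ) (X : ℕ → Fin k → ℝ) {j T : ℕ}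
    (hj : k * ⌈γ * ((j : ℝ) + 2)⌉₊ ≤ 2 ^ j) (hT : 2 ^ (j + 1) ≤ T) (i : Fin k) :
    ⌈γ * ((j : ℝ) + 2)⌉₊ ≤ nCount (eetcPull γ X) i T := by
  conv_lhs => rw [← Finset.card_range ⌈γ * ((j : ℝ) + 2)⌉₊]
  refine Finset.card_le_card_of_injOn
    (fun l => 2 ^ j + (i.val * ⌈γ * ((j : ℝ) + 2)⌉₊ + l)) (fun l hl => ?_)
    (fun a _ b _ hab => by simpa using hab)
  have hl_lt : l < ⌈γ * ((j : ℝ) + 2)⌉₊ := by simpa using hl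
  have hlt := exploration_offset_lt i hl_lt
  have hpos : 0 < 2 ^ j := by positivity
  rw [pow_succ] at hT
  rw [Finset.mem_coe, Finset.mem_filter, Finset.mem_Icc]
  dsimp only
  exact ⟨⟨by omega, by omega⟩, eetcPull_exploration γ X hj i hl_lt⟩

/-- For every realization of the rewards, a player following
`EpochExploreThenCommit_γ` has pulled every arm at least `γ log₂ T` times by round `T`,
for all `T` larger than a constant `t₀` depending only on `k` and `γ`. -/
theorem statement8 (γ : ℝ) (hγ : 0 < γ) (k : ℕ) [NeZero k] :
    ∃ t₀ : ℕ, ∀ X : ℕ → Fin k → ℝ, (∀ t i, X t i ∈ Set.Icc (-1 : ℝ) 1) →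
      ∀ i : Fin k, ∀ T : ℕ, t₀ < T →
        γ * Real.logb 2 T ≤ (nCount (eetcPull γ X) i T : ℝ) := by
  obtain ⟨j₀, hj₀⟩ := Filter.eventually_atTop.1 (eventually_mul_ceil_le_two_pow γ hγ.le k)
  refine ⟨2 ^ (j₀ + 1), fun X _ i T hT => ?_⟩
  have hT0 : T ≠ 0 := Nat.ne_zero_of_lt hT
  have hlog : j₀ + 1 ≤ Nat.log 2 T := Nat.le_log_of_pow_le one_lt_two hT.le
  obtain ⟨j, hj⟩ : ∃ j, Nat.log 2 T = j + 1 := ⟨Nat.log 2 T - 1, by omega⟩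
  have hcount := ceil_le_nCount_eetcPull γ X (hj₀ j (by omega))
    (hj ▸ Nat.pow_log_le_self 2 hT0) i
  have hlogb : Real.logb 2 T ≤ (j : ℝ) + 2 := by
    have hlt : T < 2 ^ (j + 2) := by
      simpa only [hj] using Nat.lt_pow_succ_log_self one_lt_two T
    rw [Real.logb_le_iff_le_rpow one_lt_two (by positivity)]
    exact_mod_cast hlt.le
  calc γ * Real.logb 2 T ≤ γ * ((j : ℝ) + 2) := mul_le_mul_of_nonneg_left hlogb hγ.le
    _ ≤ ⌈γ * ((j : ℝ) + 2)⌉₊ := Nat.le_ceil _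
    _ ≤ nCount (eetcPull γ X) i T := by exact_mod_cast hcount

end Freeride
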